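/- Fix λ > 0 and c > 0, and let k(τ, ν) = [ λ^{3/2}·c·ν·(4c − 2τ² − ν²) − 4√λ·c·ν − τ·(4τ² + λ·(4c² − 4cτ² + τ⁴ + τ²ν²)) ] / [ √λ·c·(4(τ²+ν²) + λ·(2c − τ² − ν²)²) ]. Let (τ, ν) : ℝ → ℝ² be a differentiable solution of the system τ' = 1 + k(τ,ν)·ν, ν' = −k(τ,ν)·τ defined on all of ℝ. Then there exists R > 0 such that k(τ(s), ν(s)) ≠ 0 for every s with |s| > R; that is, all zeros of the curvature along the solution are contained in a compact interval of ℝ. -/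

import Mathlib

open Real Set

/-- The curvature function of the planar curve generating a helicoidal vertical translator
with pitch `c` in the Heisenberg group `(Nil₃, g_λ)`, expressed in terms of the support
functions `τ = ⟨γ, T⟩` and `ν = ⟨γ, N⟩`. -/
noncomputable def helicoidalCurvature (lam c τ ν : ℝ) : ℝ :=
  ((Real.sqrt lam) ^ 3 * c * ν * (4 * c - 2 * τ ^ 2 - ν ^ 2) - 4 * Real.sqrt lam * c * ν -
      τ * (4 * τ ^ 2 + lam * (4 * c ^ 2 - 4 * c * τ ^ 2 + τ ^ 4 + τ ^ 2 * ν ^ 2))) /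
    (Real.sqrt lam * c * (4 * (τ ^ 2 + ν ^ 2) + lam * (2 * c - (τ ^ 2 + ν ^ 2)) ^ 2))

open Filter Topology

/-- A function that moves upwards whenever it meets the level `m` stays strictly above `m`. -/
theorem lt_of_deriv_pos_of_eq {f f' : ℝ → ℝ} {a m : ℝ} (hf : ∀ s, HasDerivAt f (f' s) s)
    (ha : m ≤ f a) (hpos : ∀ s, a ≤ s → f s = m → 0 < f' s) {b : ℝ} (hab : a < b) :
    m < f b := by
  have hge : ∀ x ∈ Icc a b, m ≤ f x := fun x hx =>
    image_le_of_deriv_right_lt_deriv_boundary (f := fun _ => m) (f' := fun _ => 0)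
      continuousOn_const (fun y _ => hasDerivWithinAt_const _ _ _) ha hf
      (fun y hy h => hpos y hy.1 h.symm) hx
  refine lt_of_le_of_ne (hge b (right_mem_Icc.2 hab.le)) fun hb => ?_
  have hslope := (hasDerivAt_iff_tendsto_slope.1 (hf b)).eventually
    (lt_mem_nhds (hpos b hab.le hb.symm))
  have hleft : ∀ᶠ x in 𝓝[<] b, 0 < slope f b x :=
    hslope.filter_mono (nhdsWithin_mono b fun x hx => ne_of_lt hx)
  obtain ⟨x, hx, hxab⟩ := (hleft.and (Ioo_mem_nhdsLT hab)).exists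
  rw [slope_def_field] at hx
  have hneg : f x - f b < 0 := by
    by_contra! h
    exact absurd hx (not_lt.2 (div_nonpos_of_nonneg_of_nonpos h (by linarith [hxab.2])))
  linarith [hge x ⟨hxab.1.le, hxab.2.le⟩]

theorem add_mul_sub_le_of_le_deriv {f f' : ℝ → ℝ} {a m : ℝ} (hf : ∀ s, HasDerivAt f (f' s) s)
    (hm : ∀ s, a ≤ s → m ≤ f' s) {b : ℝ} (hab : a ≤ b) : f a + m * (b - a) ≤ f b := by
  have := (convex_Ici a).mul_sub_le_image_sub_of_le_deriv (f := f) (C := m)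
    (fun x _ => (hf x).continuousAt.continuousWithinAt)
    (fun x _ => (hf x).differentiableAt.differentiableWithinAt)
    (fun x hx => by
      rw [(hf x).deriv]
      exact hm x (interior_subset hx)) a self_mem_Ici b hab hab
  linarith

/-- If a continuous function is positive on the axis `{0} × ℝ`, it is uniformly positive near the
part of the axis inside a given disc. -/
theorem exists_pos_le_of_pos_on_axis {F : ℝ × ℝ → ℝ} (hF : Continuous F)
    (hF0 : ∀ y, 0 < F (0, y)) (M : ℝ) :
    ∃ δ > 0, ∀ x y : ℝ, x ^ 2 + y ^ 2 ≤ M → |x| < δ → δ ≤ F (x, y) := by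
  have hK : IsCompact (Icc (-√M) √M ×ˢ Icc (-√M) √M) := isCompact_Icc.prod isCompact_Icc
  have hne : (Icc (-√M) √M ×ˢ Icc (-√M) √M).Nonempty :=
    ⟨(0, 0), by simp [Real.sqrt_nonneg]⟩
  obtain ⟨p, -, hp⟩ := hK.exists_isMinOn hne
    (f := fun q : ℝ × ℝ => max |q.1| (F q)) (by fun_prop)
  refine ⟨max |p.1| (F p), ?_, fun x y hxy hx => ?_⟩
  · obtain ⟨p₁, p₂⟩ := p
    rcases eq_or_ne p₁ 0 with rfl | h
    · exact lt_max_of_lt_right (hF0 p₂)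
    · exact lt_max_of_lt_left (abs_pos.2 h)
  · have hmem : (x, y) ∈ Icc (-√M) √M ×ˢ Icc (-√M) √M :=
      ⟨abs_le.1 (Real.abs_le_sqrt (by nlinarith [sq_nonneg y])),
        abs_le.1 (Real.abs_le_sqrt (by nlinarith [sq_nonneg x]))⟩
    have hmin : max |p.1| (F p) ≤ max |x| (F (x, y)) := hp hmem
    rcases le_max_iff.1 hmin with h | h
    · exact absurd hx (not_lt.2 h)
    · exact h

/-- A planar curve with `x' = F(x, y)`, `F` positive on the axis `x = 0`, and `(x² + y²)' = 2x`
escapes to infinity with `x > 0`. -/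
theorem eventually_pos_and_sq_add_sq_large {F : ℝ × ℝ → ℝ} (hF : Continuous F)
    (hF0 : ∀ y, 0 < F (0, y)) {x y : ℝ → ℝ} (hx : ∀ s, HasDerivAt x (F (x s, y s)) s)
    (hr : ∀ s, HasDerivAt (fun t => x t ^ 2 + y t ^ 2) (2 * x s) s) (M : ℝ) :
    ∃ s₀, ∀ s, s₀ ≤ s → 0 < x s ∧ M < x s ^ 2 + y s ^ 2 := by
  have hr_nonneg : ∀ s, 0 ≤ x s ^ 2 + y s ^ 2 := fun s => by positivity
  obtain ⟨s₀, hs₀⟩ : ∃ s₀, 0 < x s₀ := by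
    by_contra! hneg
    obtain ⟨δ, hδ, hδF⟩ := exists_pos_le_of_pos_on_axis hF hF0 (x 0 ^ 2 + y 0 ^ 2)
    have hbound : ∀ s, 0 ≤ s → x s ^ 2 + y s ^ 2 ≤ x 0 ^ 2 + y 0 ^ 2 := fun s hs => by
      have := add_mul_sub_le_of_le_deriv (m := 0) (fun t => (hr t).neg)
        (fun t _ => by linarith [hneg t]) hs
      simp only [Pi.neg_apply] at this
      linarith
    obtain ⟨a, ha, hxa⟩ : ∃ a, 0 ≤ a ∧ -(δ / 2) < x a := by
      by_contra! h
      set b := (x 0 ^ 2 + y 0 ^ 2 + 1) / δ with hb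
      have hb0 : 0 ≤ b := by have := hr_nonneg 0; positivity
      have := add_mul_sub_le_of_le_deriv (m := δ) (fun t => (hr t).neg)
        (fun t ht => by linarith [h t ht]) hb0
      simp only [Pi.neg_apply] at this
      have hδb : δ * b = x 0 ^ 2 + y 0 ^ 2 + 1 := by rw [hb]; field_simp
      linarith [hr_nonneg b]
    have hFge : ∀ s, a ≤ s → -(δ / 2) ≤ x s → δ ≤ F (x s, y s) := fun s hs hxs =>
      hδF _ _ (hbound s (ha.trans hs)) (abs_lt.2 ⟨by linarith, by linarith [hneg s]⟩)
    have hxge : ∀ s, a ≤ s → -(δ / 2) ≤ x s := fun s hs => by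
      rcases hs.eq_or_lt with rfl | h
      · exact hxa.le
      · exact (lt_of_deriv_pos_of_eq hx hxa.le
          (fun t ht hxt => hδ.trans_le (hFge t ht hxt.ge)) h).le
    have := add_mul_sub_le_of_le_deriv hx (fun t ht => hFge t ht (hxge t ht))
      (show a ≤ a + 1 by linarith)
    linarith [hneg (a + 1)]
  have hpos : ∀ s, s₀ ≤ s → 0 < x s := fun s hs => by
    rcases hs.eq_or_lt with rfl | h
    · exact hs₀
    · exact lt_of_deriv_pos_of_eq hx hs₀.le (fun t _ hxt => by rw [hxt]; exact hF0 _) h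
  have hmono : ∀ a b, s₀ ≤ a → a ≤ b → x a ^ 2 + y a ^ 2 ≤ x b ^ 2 + y b ^ 2 :=
    fun a b ha hab => by
      have := add_mul_sub_le_of_le_deriv (m := 0) hr
        (fun t ht => by linarith [hpos t (ha.trans ht)]) hab
      linarith
  obtain ⟨s₁, hs₁, hM⟩ : ∃ s₁, s₀ ≤ s₁ ∧ M < x s₁ ^ 2 + y s₁ ^ 2 := by
    by_contra! hbound
    obtain ⟨δ, hδ, hδF⟩ := exists_pos_le_of_pos_on_axis hF hF0 M
    set m := min (x s₀) (δ / 2) with hm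
    have hm0 : 0 < m := lt_min hs₀ (by linarith)
    have hxge : ∀ s, s₀ ≤ s → m ≤ x s := fun s hs => by
      rcases hs.eq_or_lt with rfl | h
      · exact min_le_left _ _
      · refine (lt_of_deriv_pos_of_eq hx (min_le_left _ _) (fun t ht hxt => ?_) h).le
        refine hδ.trans_le (hδF _ _ (hbound t ht) ?_)
        rw [hxt, abs_of_pos hm0]
        linarith [min_le_right (x s₀) (δ / 2)]
    have hM0 : 0 ≤ M := (hr_nonneg s₀).trans (hbound s₀ le_rfl)
    have hb : s₀ ≤ s₀ + (M + 1) / m := by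
      have : 0 ≤ (M + 1) / m := by positivity
      linarith
    have := add_mul_sub_le_of_le_deriv (m := m) hr
      (fun t ht => by linarith [hxge t ht]) hb
    have hmul : m * (s₀ + (M + 1) / m - s₀) = M + 1 := by field_simp; ring
    linarith [hbound _ hb, hr_nonneg s₀]
  exact ⟨s₁, fun s hs => ⟨hpos s (hs₁.trans hs), hM.trans_le (hmono s₁ s hs₁ hs)⟩⟩

/-- The numerator of `helicoidalCurvature (μ ^ 2) c x y`. -/
def helicoidalNumerator (μ c x y : ℝ) : ℝ :=
  μ ^ 3 * c * y * (4 * c - 2 * x ^ 2 - y ^ 2) - 4 * μ * c * y -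
    x * (4 * x ^ 2 + μ ^ 2 * (4 * c ^ 2 - 4 * c * x ^ 2 + x ^ 4 + x ^ 2 * y ^ 2))

/-- The partial derivative of `helicoidalNumerator μ c x y` in `x`. -/
def helicoidalNumeratorDerivLeft (μ c x y : ℝ) : ℝ :=
  -(4 * μ ^ 3 * c * x * y) -
    (12 * x ^ 2 + μ ^ 2 * (4 * c ^ 2 - 12 * c * x ^ 2 + 5 * x ^ 4 + 3 * x ^ 2 * y ^ 2))

/-- The partial derivative of `helicoidalNumerator μ c x y` in `y`. -/
def helicoidalNumeratorDerivRight (μ c x y : ℝ) : ℝ :=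
  μ ^ 3 * c * (4 * c - 2 * x ^ 2 - 3 * y ^ 2) - 4 * μ * c - 2 * μ ^ 2 * x ^ 3 * y

theorem hasDerivAt_helicoidalNumerator (μ c : ℝ) {x y : ℝ → ℝ} {x' y' s : ℝ}
    (hx : HasDerivAt x x' s) (hy : HasDerivAt y y' s) :
    HasDerivAt (fun t => helicoidalNumerator μ c (x t) (y t))
      (helicoidalNumeratorDerivLeft μ c (x s) (y s) * x' +
        helicoidalNumeratorDerivRight μ c (x s) (y s) * y') s := by
  unfold helicoidalNumerator helicoidalNumeratorDerivLeft helicoidalNumeratorDerivRight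
  have h₁ := (hy.const_mul (μ ^ 3 * c)).mul
    (((hx.pow 2).const_mul 2).const_sub (4 * c) |>.sub (hy.pow 2))
  have h₂ := hy.const_mul (4 * μ * c)
  have h₃ := hx.mul (((hx.pow 2).const_mul 4).add
    (((((hx.pow 2).const_mul (4 * c)).const_sub (4 * c ^ 2)).add (hx.pow 4)).add
      ((hx.pow 2).mul (hy.pow 2)) |>.const_mul (μ ^ 2)))
  refine ((h₁.sub h₂).sub h₃).congr_deriv ?_
  simp only [Pi.add_apply, Pi.sub_apply, Pi.mul_apply, Pi.pow_apply]
  push_cast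
  ring

/-- Far from the origin in the half-plane `x > 0`, the numerator of the curvature is decreasing
in `x` along its zero set. -/
theorem helicoidalNumeratorDerivLeft_neg {μ c x y : ℝ} (hμ : 0 < μ) (hc : 0 < c) (hx : 0 < x)
    (hr : 4 * |4 * μ ^ 2 * c - 4| / μ ^ 2 + 4 * μ * c < x ^ 2 + y ^ 2)
    (h0 : helicoidalNumerator μ c x y = 0) : helicoidalNumeratorDerivLeft μ c x y < 0 := by
  set S := 4 * μ ^ 2 * c - 4 with hS
  have hS_le : 4 * |S| ≤ μ ^ 2 * (x ^ 2 + y ^ 2) := by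
    have h : 4 * |S| / μ ^ 2 ≤ x ^ 2 + y ^ 2 := by nlinarith [mul_pos hμ hc]
    rw [div_le_iff₀ (by positivity)] at h
    linarith
  have hr' : 4 * μ * c < x ^ 2 + y ^ 2 := by
    have : 0 ≤ 4 * |S| / μ ^ 2 := by positivity
    linarith
  have hS₁ := le_abs_self S
  have hS₂ := neg_abs_le S
  have hr0 : 0 < x ^ 2 + y ^ 2 := by positivity
  have hμr : 0 < μ ^ 2 * (x ^ 2 + y ^ 2) := by positivity
  set P := x ^ 2 * (μ ^ 2 * (x ^ 2 + y ^ 2) - S) + 4 * μ ^ 2 * c ^ 2 with hP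
  have hQ : 0 < 2 * μ ^ 2 * x ^ 2 + μ ^ 2 * y ^ 2 - S := by
    nlinarith [mul_pos (pow_pos hμ 2) (pow_pos hx 2)]
  have hPpos : 0 < P := by
    have h₁ : 0 < μ ^ 2 * (x ^ 2 + y ^ 2) - S := by linarith
    positivity
  have hzero : x * P = μ * c * (-y) * (2 * μ ^ 2 * x ^ 2 + μ ^ 2 * y ^ 2 - S) := by
    unfold helicoidalNumerator at h0
    rw [hP, hS]
    linarith
  have hy : 0 < -y := by
    have h₁ : 0 < μ * c * (2 * μ ^ 2 * x ^ 2 + μ ^ 2 * y ^ 2 - S) * (-y) := by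
      have := mul_pos hx hPpos
      linarith
    exact pos_of_mul_pos_right h₁ (by positivity)
  have hkey : μ * c * (-y) * (2 * μ ^ 2 * x ^ 2 - μ ^ 2 * y ^ 2 + S) <
      2 * x ^ 3 * (μ ^ 2 * (x ^ 2 + y ^ 2) - S) + 2 * μ ^ 2 * x ^ 5 := by
    have hx5 : 0 < μ ^ 2 * x ^ 5 := by positivity
    have hlow : 2 * x ^ 3 * (3 / 4 * (μ ^ 2 * (x ^ 2 + y ^ 2))) ≤
        2 * x ^ 3 * (μ ^ 2 * (x ^ 2 + y ^ 2) - S) := by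
      gcongr
      linarith
    rcases le_or_gt (2 * μ ^ 2 * x ^ 2 - μ ^ 2 * y ^ 2 + S) 0 with h | h
    · have h₁ : μ * c * (-y) * (2 * μ ^ 2 * x ^ 2 - μ ^ 2 * y ^ 2 + S) ≤ 0 :=
        mul_nonpos_of_nonneg_of_nonpos (by positivity) h
      have h₂ : 0 < 2 * x ^ 3 * (3 / 4 * (μ ^ 2 * (x ^ 2 + y ^ 2))) := by positivity
      linarith
    · have hrx : x ^ 2 + y ^ 2 < 4 * x ^ 2 := by
        have : μ ^ 2 * (x ^ 2 + y ^ 2) < μ ^ 2 * (4 * x ^ 2) := by linarith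
        exact lt_of_mul_lt_mul_left this (by positivity)
      have hyx : -y ≤ 2 * x := le_of_sq_le_sq (by nlinarith [sq_nonneg x]) (by positivity)
      have hfac : 2 * μ ^ 2 * x ^ 2 - μ ^ 2 * y ^ 2 + S ≤ 3 * μ ^ 2 * x ^ 2 := by
        have : μ ^ 2 * (x ^ 2 + y ^ 2) ≤ μ ^ 2 * (4 * x ^ 2) := by gcongr
        nlinarith [mul_nonneg (sq_nonneg μ) (sq_nonneg y)]
      have h₁ : μ * c * (-y) * (2 * μ ^ 2 * x ^ 2 - μ ^ 2 * y ^ 2 + S) ≤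
          μ * c * (2 * x) * (3 * μ ^ 2 * x ^ 2) := by gcongr
      have h₂ : 3 / 2 * μ ^ 2 * x ^ 3 * (4 * μ * c) ≤
          3 / 2 * μ ^ 2 * x ^ 3 * (x ^ 2 + y ^ 2) := by gcongr
      linarith
  have hmul : x * helicoidalNumeratorDerivLeft μ c x y =
      μ * c * (-y) * (2 * μ ^ 2 * x ^ 2 - μ ^ 2 * y ^ 2 + S) -
        (2 * x ^ 3 * (μ ^ 2 * (x ^ 2 + y ^ 2) - S) + 2 * μ ^ 2 * x ^ 5) := by
    have : x * helicoidalNumeratorDerivLeft μ c x y = 4 * μ ^ 3 * c * (-y) * x ^ 2 - x * P -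
        (2 * x ^ 3 * (μ ^ 2 * (x ^ 2 + y ^ 2) - S) + 2 * μ ^ 2 * x ^ 5) := by
      rw [hP, hS]
      unfold helicoidalNumeratorDerivLeft
      ring
    rw [this, hzero]
    ring
  have : x * helicoidalNumeratorDerivLeft μ c x y < 0 := by linarith
  exact neg_of_mul_neg_right this hx.le

section Curvature

variable {lam c : ℝ}

theorem helicoidalCurvature_denom_pos (hlam : 0 < lam) (hc : 0 < c) (x y : ℝ) :
    0 < √lam * c * (4 * (x ^ 2 + y ^ 2) + lam * (2 * c - (x ^ 2 + y ^ 2)) ^ 2) := by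
  have : 0 < 4 * (x ^ 2 + y ^ 2) + lam * (2 * c - (x ^ 2 + y ^ 2)) ^ 2 := by
    rcases (add_nonneg (sq_nonneg x) (sq_nonneg y)).eq_or_lt with h | h
    · rw [← h, sub_zero]
      positivity
    · positivity
  positivity

theorem helicoidalCurvature_eq_zero_iff (hlam : 0 < lam) (hc : 0 < c) (x y : ℝ) :
    helicoidalCurvature lam c x y = 0 ↔ helicoidalNumerator √lam c x y = 0 := by
  rw [helicoidalCurvature, helicoidalNumerator,
    div_eq_zero_iff, or_iff_left (helicoidalCurvature_denom_pos hlam hc x y).ne',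
    Real.sq_sqrt hlam.le]

theorem continuous_helicoidalCurvature (hlam : 0 < lam) (hc : 0 < c) :
    Continuous fun p : ℝ × ℝ => helicoidalCurvature lam c p.1 p.2 := by
  unfold helicoidalCurvature
  exact Continuous.div (by fun_prop) (by fun_prop)
    fun p => (helicoidalCurvature_denom_pos hlam hc p.1 p.2).ne'

theorem one_add_helicoidalCurvature_mul_pos (hlam : 0 < lam) (hc : 0 < c) (y : ℝ) :
    0 < 1 + helicoidalCurvature lam c 0 y * y := by
  have hD := helicoidalCurvature_denom_pos hlam hc 0 y
  have hμ := Real.sqrt_pos.2 hlam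
  have h : 1 + helicoidalCurvature lam c 0 y * y = 4 * √lam * lam * c ^ 3 /
      (√lam * c * (4 * (0 ^ 2 + y ^ 2) + lam * (2 * c - (0 ^ 2 + y ^ 2)) ^ 2)) := by
    rw [helicoidalCurvature, div_mul_eq_mul_div, one_add_div hD.ne', pow_succ √lam 2,
      Real.sq_sqrt hlam.le]
    ring
  rw [h]
  positivity

theorem helicoidalCurvature_neg (lam c x y : ℝ) :
    helicoidalCurvature lam c (-x) (-y) = -helicoidalCurvature lam c x y := by
  unfold helicoidalCurvature
  rw [← neg_div]
  congr 1 <;> ring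

theorem helicoidalCurvature_eventually_ne_zero (hlam : 0 < lam) (hc : 0 < c) {τ ν : ℝ → ℝ}
    (hτ : ∀ s : ℝ, HasDerivAt τ (1 + helicoidalCurvature lam c (τ s) (ν s) * ν s) s)
    (hν : ∀ s : ℝ, HasDerivAt ν (-(helicoidalCurvature lam c (τ s) (ν s)) * τ s) s) :
    ∃ R, ∀ s, R < s → helicoidalCurvature lam c (τ s) (ν s) ≠ 0 := by
  have hr : ∀ s, HasDerivAt (fun t => τ t ^ 2 + ν t ^ 2) (2 * τ s) s := fun s => by
    refine (((hτ s).pow 2).add ((hν s).pow 2)).congr_deriv ?_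
    push_cast
    ring
  obtain ⟨s₀, hs₀⟩ := eventually_pos_and_sq_add_sq_large
    (F := fun p => 1 + helicoidalCurvature lam c p.1 p.2 * p.2)
    (continuous_const.add ((continuous_helicoidalCurvature hlam hc).mul continuous_snd))
    (one_add_helicoidalCurvature_mul_pos hlam hc) hτ hr
    (4 * |4 * √lam ^ 2 * c - 4| / √lam ^ 2 + 4 * √lam * c)
  by_cases h : ∃ a, s₀ ≤ a ∧ helicoidalCurvature lam c (τ a) (ν a) = 0
  · obtain ⟨a, ha, hka⟩ := h
    refine ⟨a, fun s hs hks => ?_⟩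
    rw [helicoidalCurvature_eq_zero_iff hlam hc] at hka hks
    have := lt_of_deriv_pos_of_eq (m := 0)
      (fun t => (hasDerivAt_helicoidalNumerator √lam c (hτ t) (hν t)).neg)
      (by simp [hka]) (fun t ht h0 => ?_) hs
    · simp [hks] at this
    · have h0' : helicoidalNumerator √lam c (τ t) (ν t) = 0 := neg_eq_zero.1 h0
      obtain ⟨hpos, hlarge⟩ := hs₀ t (ha.trans ht)
      rw [(helicoidalCurvature_eq_zero_iff hlam hc _ _).2 h0']
      have := helicoidalNumeratorDerivLeft_neg (Real.sqrt_pos.2 hlam) hc hpos hlarge h0'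
      simpa using this
  · push Not at h
    exact ⟨s₀, fun s hs => h s hs.le⟩

end Curvature

/-- Along a global solution of `τ' = 1 + kν`, `ν' = −kτ`, all zeros of the curvature `k`
are contained in a compact interval. -/
theorem helicoidal_curvature_zeros_compact
    (lam c : ℝ) (hlam : 0 < lam) (hc : 0 < c) (τ ν : ℝ → ℝ)
    (hτ : ∀ s : ℝ, HasDerivAt τ (1 + helicoidalCurvature lam c (τ s) (ν s) * ν s) s)
    (hν : ∀ s : ℝ, HasDerivAt ν (-(helicoidalCurvature lam c (τ s) (ν s)) * τ s) s) :
    ∃ R > (0 : ℝ), ∀ s : ℝ, R < |s| → helicoidalCurvature lam c (τ s) (ν s) ≠ 0 := by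
  obtain ⟨R₁, hR₁⟩ := helicoidalCurvature_eventually_ne_zero hlam hc hτ hν
  obtain ⟨R₂, hR₂⟩ := helicoidalCurvature_eventually_ne_zero hlam hc
    (τ := fun s => -τ (-s)) (ν := fun s => -ν (-s))
    (fun s => by
      refine ((hτ (-s)).scomp s (hasDerivAt_neg s)).neg.congr_deriv ?_
      simp [helicoidalCurvature_neg])
    (fun s => by
      refine ((hν (-s)).scomp s (hasDerivAt_neg s)).neg.congr_deriv ?_
      simp [helicoidalCurvature_neg])
  refine ⟨max 1 (max R₁ R₂), lt_max_of_lt_left one_pos, fun s hs => ?_⟩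
  obtain ⟨-, hs₁, hs₂⟩ : 1 < |s| ∧ R₁ < |s| ∧ R₂ < |s| := by simpa using hs
  rcases abs_choice s with h | h
  · exact hR₁ s (h ▸ hs₁)
  · have := hR₂ (-s) (h ▸ hs₂)
    simpa [helicoidalCurvature_neg] using this
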